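/- The closed unit l₁-ball B = {x ∈ ℝ³ : ‖x‖₁ ≤ 1} is covered by the following fourteen sets, each of which has l₁-diameter at most 1: the six l₁-balls {x ∈ ℝ³ : ‖x − c‖₁ ≤ 1/2} with center c ranging over (±1/2, 0, 0), (0, ±1/2, 0), (0, 0, ±1/2), together with the eight convex hulls conv{(0,0,0), (ε₁/2, ε₂/2, 0), (ε₁/2, 0, ε₃/2), (0, ε₂/2, ε₃/2)} where (ε₁, ε₂, ε₃) ranges over {−1, 1}³. -/

import Mathlib

/-- The `l₁`-ball of radius `r` centered at `c` in `ℝ³`. -/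
def l1Ball (c : Fin 3 → ℝ) (r : ℝ) : Set (Fin 3 → ℝ) := {x | ∑ i, |x i - c i| ≤ r}

/-- The pyramid with vertices `(0,0,0)`, `(ε₁/2, ε₂/2, 0)`, `(ε₁/2, 0, ε₃/2)`,
`(0, ε₂/2, ε₃/2)` determined by a sign vector `ε`. -/
def pyramid (ε : Fin 3 → ℝ) : Set (Fin 3 → ℝ) :=
  convexHull ℝ {![0, 0, 0], ![ε 0 / 2, ε 1 / 2, 0], ![ε 0 / 2, 0, ε 2 / 2],
    ![0, ε 1 / 2, ε 2 / 2]}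

/-- The six centers `(±1/2, 0, 0)`, `(0, ±1/2, 0)`, `(0, 0, ±1/2)`. -/
def sixCenters : Set (Fin 3 → ℝ) :=
  {![1/2, 0, 0], ![-(1/2), 0, 0], ![0, 1/2, 0], ![0, -(1/2), 0], ![0, 0, 1/2],
    ![0, 0, -(1/2)]}

/-- The half-space description of the pyramid: it is cut out by four linear inequalities. -/
theorem mem_pyramid_iff {ε : Fin 3 → ℝ} (hε : ∀ i, ε i = 1 ∨ ε i = -1) (x : Fin 3 → ℝ) :
    x ∈ pyramid ε ↔
      ε 0 * x 0 ≤ ε 1 * x 1 + ε 2 * x 2 ∧ ε 1 * x 1 ≤ ε 0 * x 0 + ε 2 * x 2 ∧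
      ε 2 * x 2 ≤ ε 0 * x 0 + ε 1 * x 1 ∧ ε 0 * x 0 + ε 1 * x 1 + ε 2 * x 2 ≤ 1 := by
  have hsq : ∀ i, ε i * ε i = 1 := fun i => by rcases hε i with h | h <;> simp [h]
  have h0 := hsq 0
  have h1 := hsq 1
  have h2 := hsq 2
  constructor
  · let S : Set (Fin 3 → ℝ) := {x | ε 0 * x 0 ≤ ε 1 * x 1 + ε 2 * x 2 ∧
      ε 1 * x 1 ≤ ε 0 * x 0 + ε 2 * x 2 ∧ ε 2 * x 2 ≤ ε 0 * x 0 + ε 1 * x 1 ∧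
      ε 0 * x 0 + ε 1 * x 1 + ε 2 * x 2 ≤ 1}
    have hS : Convex ℝ S := by
      rintro u ⟨hu0, hu1, hu2, hu3⟩ v ⟨hv0, hv1, hv2, hv3⟩ a b ha hb hab
      refine ⟨?_, ?_, ?_, ?_⟩ <;> simp only [Pi.add_apply, Pi.smul_apply, smul_eq_mul]
      · linarith [mul_le_mul_of_nonneg_left hu0 ha, mul_le_mul_of_nonneg_left hv0 hb]
      · linarith [mul_le_mul_of_nonneg_left hu1 ha, mul_le_mul_of_nonneg_left hv1 hb]
      · linarith [mul_le_mul_of_nonneg_left hu2 ha, mul_le_mul_of_nonneg_left hv2 hb]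
      · linarith [mul_le_mul_of_nonneg_left hu3 ha, mul_le_mul_of_nonneg_left hv3 hb]
    refine fun hx => convexHull_min (t := S) ?_ hS hx
    rintro y (rfl | rfl | rfl | rfl) <;> refine ⟨?_, ?_, ?_, ?_⟩ <;> simp <;> linarith
  · rintro ⟨hx0, hx1, hx2, hx3⟩
    let w : Fin 4 → ℝ := ![1 - (ε 0 * x 0 + ε 1 * x 1 + ε 2 * x 2),
      ε 0 * x 0 + ε 1 * x 1 - ε 2 * x 2, ε 0 * x 0 + ε 2 * x 2 - ε 1 * x 1,
      ε 1 * x 1 + ε 2 * x 2 - ε 0 * x 0]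
    let z : Fin 4 → Fin 3 → ℝ := ![![0, 0, 0], ![ε 0 / 2, ε 1 / 2, 0], ![ε 0 / 2, 0, ε 2 / 2],
      ![0, ε 1 / 2, ε 2 / 2]]
    have hx : ∑ i, w i • z i = x := by
      ext j
      fin_cases j <;> simp [w, z, Fin.sum_univ_four]
      · linear_combination x 0 * h0
      · linear_combination x 1 * h1
      · linear_combination x 2 * h2
    rw [← hx]
    refine (convex_convexHull ℝ _).sum_mem (fun i _ => ?_) ?_
      (fun i _ => subset_convexHull ℝ _ ?_)
    · fin_cases i <;> simp [w] <;> linarith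
    · simp only [w, Fin.sum_univ_four, Matrix.cons_val]
      ring
    · fin_cases i <;> simp [z]

/-- The `l₁`-diameter of an `l₁`-ball is at most twice its radius. -/
theorem sum_abs_sub_le_of_mem_l1Ball {c u v : Fin 3 → ℝ} {r : ℝ} (hu : u ∈ l1Ball c r)
    (hv : v ∈ l1Ball c r) : ∑ i, |u i - v i| ≤ 2 * r := by
  calc ∑ i, |u i - v i| ≤ ∑ i, (|u i - c i| + |v i - c i|) :=
        Finset.sum_le_sum fun i _ => by
          rw [abs_sub_comm (v i)]
          exact abs_sub_le _ _ _
    _ = ∑ i, |u i - c i| + ∑ i, |v i - c i| := Finset.sum_add_distrib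
    _ ≤ 2 * r := by linarith [show _ ≤ r from hu, show _ ≤ r from hv]

/-- The pyramid of a sign vector has `l₁`-diameter at most `1`. -/
theorem sum_abs_sub_le_of_mem_pyramid {ε u v : Fin 3 → ℝ} (hε : ∀ i, ε i = 1 ∨ ε i = -1)
    (hu : u ∈ pyramid ε) (hv : v ∈ pyramid ε) : ∑ i, |u i - v i| ≤ 1 := by
  obtain ⟨hu0, hu1, hu2, hu3⟩ := (mem_pyramid_iff hε u).1 hu
  obtain ⟨hv0, hv1, hv2, hv3⟩ := (mem_pyramid_iff hε v).1 hv
  have habs : ∀ i, |u i - v i| = |ε i * u i - ε i * v i| := fun i => by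
    rw [← mul_sub, abs_mul]
    rcases hε i with h | h <;> simp [h]
  simp only [Fin.sum_univ_three, habs]
  rcases abs_cases (ε 0 * u 0 - ε 0 * v 0) with ⟨h0, _⟩ | ⟨h0, _⟩ <;>
  rcases abs_cases (ε 1 * u 1 - ε 1 * v 1) with ⟨h1, _⟩ | ⟨h1, _⟩ <;>
  rcases abs_cases (ε 2 * u 2 - ε 2 * v 2) with ⟨h2, _⟩ | ⟨h2, _⟩ <;>
  linarith

/-- A point of the unit `l₁`-ball with one dominating coordinate lies in one of the six balls. -/
theorem exists_mem_l1Ball_of_dominant {x : Fin 3 → ℝ} (hx : ∑ i, |x i| ≤ 1)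
    (h : |x 1| + |x 2| ≤ |x 0| ∨ |x 0| + |x 2| ≤ |x 1| ∨ |x 0| + |x 1| ≤ |x 2|) :
    ∃ c ∈ sixCenters, x ∈ l1Ball c (1/2) := by
  have key : ∀ t s : ℝ, 0 ≤ t → t + s ≤ 1 → s ≤ t → |t - 1/2| + s ≤ 1/2 := by
    intro t s _ _ _
    rcases abs_cases (t - 1/2) with ⟨h, _⟩ | ⟨h, _⟩ <;> linarith
  have key' : ∀ t s : ℝ, |t| + s ≤ 1 → s ≤ |t| →
      |t - 1/2| + s ≤ 1/2 ∨ |t - -(1/2)| + s ≤ 1/2 := by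
    intro t s hts hst
    rcases abs_cases t with ⟨h, ht⟩ | ⟨h, ht⟩ <;> rw [h] at hts hst
    · exact .inl (key t s ht hts hst)
    · refine .inr ?_
      have := key (-t) s (by linarith) hts hst
      rwa [← abs_neg, show -(t - -(1/2)) = -t - 1/2 by ring]
  rw [Fin.sum_univ_three] at hx
  rcases h with h | h | h
  · rcases key' (x 0) (|x 1| + |x 2|) (by linarith) h with h' | h'
    · refine ⟨![1/2, 0, 0], by simp [sixCenters], ?_⟩
      simp only [l1Ball, Set.mem_ofPred_eq, Fin.sum_univ_three, Matrix.cons_val, sub_zero]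
      linarith
    · refine ⟨![-(1/2), 0, 0], by simp [sixCenters], ?_⟩
      simp only [l1Ball, Set.mem_ofPred_eq, Fin.sum_univ_three, Matrix.cons_val, sub_zero]
      linarith
  · rcases key' (x 1) (|x 0| + |x 2|) (by linarith) h with h' | h'
    · refine ⟨![0, 1/2, 0], by simp [sixCenters], ?_⟩
      simp only [l1Ball, Set.mem_ofPred_eq, Fin.sum_univ_three, Matrix.cons_val, sub_zero]
      linarith
    · refine ⟨![0, -(1/2), 0], by simp [sixCenters], ?_⟩
      simp only [l1Ball, Set.mem_ofPred_eq, Fin.sum_univ_three, Matrix.cons_val, sub_zero]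
      linarith
  · rcases key' (x 2) (|x 0| + |x 1|) (by linarith) h with h' | h'
    · refine ⟨![0, 0, 1/2], by simp [sixCenters], ?_⟩
      simp only [l1Ball, Set.mem_ofPred_eq, Fin.sum_univ_three, Matrix.cons_val, sub_zero]
      linarith
    · refine ⟨![0, 0, -(1/2)], by simp [sixCenters], ?_⟩
      simp only [l1Ball, Set.mem_ofPred_eq, Fin.sum_univ_three, Matrix.cons_val, sub_zero]
      linarith

/-- A point of the unit `l₁`-ball without dominating coordinate lies in one of the pyramids. -/
theorem exists_mem_pyramid_of_not_dominant {x : Fin 3 → ℝ} (hx : ∑ i, |x i| ≤ 1)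
    (h0 : |x 0| ≤ |x 1| + |x 2|) (h1 : |x 1| ≤ |x 0| + |x 2|) (h2 : |x 2| ≤ |x 0| + |x 1|) :
    ∃ ε : Fin 3 → ℝ, (∀ i, ε i = 1 ∨ ε i = -1) ∧ x ∈ pyramid ε := by
  have hsign : ∀ i, ∃ e : ℝ, (e = 1 ∨ e = -1) ∧ e * x i = |x i| := fun i => by
    rcases abs_choice (x i) with h | h
    · exact ⟨1, .inl rfl, by rw [h, one_mul]⟩
    · exact ⟨-1, .inr rfl, by rw [h, neg_one_mul]⟩
  choose ε hε hεx using hsign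
  rw [Fin.sum_univ_three] at hx
  refine ⟨ε, hε, (mem_pyramid_iff hε x).2 ?_⟩
  simp only [hεx]
  exact ⟨h0, h1, h2, hx⟩

/-- the closed unit `l₁`-ball of `ℝ³` is covered by six `l₁`-balls of radius
`1/2` and eight pyramids, each of these fourteen sets having `l₁`-diameter at most `1`. -/
theorem unit_l1Ball_cover_fourteen_sets :
    ({x : Fin 3 → ℝ | ∑ i, |x i| ≤ 1} ⊆
        (⋃ c ∈ sixCenters, l1Ball c (1/2)) ∪
        (⋃ ε ∈ {ε : Fin 3 → ℝ | ∀ i, ε i = 1 ∨ ε i = -1}, pyramid ε)) ∧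
    (∀ c ∈ sixCenters, ∀ u ∈ l1Ball c (1/2), ∀ v ∈ l1Ball c (1/2),
        ∑ i, |u i - v i| ≤ 1) ∧
    (∀ ε : Fin 3 → ℝ, (∀ i, ε i = 1 ∨ ε i = -1) →
        ∀ u ∈ pyramid ε, ∀ v ∈ pyramid ε, ∑ i, |u i - v i| ≤ 1) := by
  refine ⟨fun x hx => ?_, fun c _ u hu v hv => ?_,
    fun ε hε u hu v hv => sum_abs_sub_le_of_mem_pyramid hε hu hv⟩
  · by_cases h : |x 1| + |x 2| ≤ |x 0| ∨ |x 0| + |x 2| ≤ |x 1| ∨ |x 0| + |x 1| ≤ |x 2|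
    · obtain ⟨c, hc, hxc⟩ := exists_mem_l1Ball_of_dominant hx h
      exact .inl (Set.mem_biUnion hc hxc)
    · push Not at h
      obtain ⟨ε, hε, hxε⟩ :=
        exists_mem_pyramid_of_not_dominant hx h.1.le h.2.1.le h.2.2.le
      exact .inr (Set.mem_biUnion (show ε ∈ {ε : Fin 3 → ℝ | _} from hε) hxε)
  · exact (sum_abs_sub_le_of_mem_l1Ball hu hv).trans_eq (by norm_num)
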